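/- Every salami is flat: if G=(V,w,m,d) is a salami, then for every vertex x ∈ V one has κ(x) := inf_{y∼x} κ(x,y) = 0. -/

import Mathlib

open Filter

namespace SalamiPaper

variable {V : Type*}

/-- Locally finite: every vertex has finitely many neighbors. -/
def LocallyFinite (w : V → V → ℝ) : Prop := ∀ x : V, {y | 0 < w x y}.Finite

/-- Connectedness of the weighted graph: any two vertices are joined by a path. -/
def GraphConnected (w : V → V → ℝ) : Prop :=
  ∀ x y : V, Relation.ReflTransGen (fun a b => 0 < w a b) x y

/-- The weighted graph Laplacian `Δf(x) = (1/m(x)) ∑_y w(x,y)(f(y)-f(x))`. -/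
noncomputable def lap (w : V → V → ℝ) (m : V → ℝ) (f : V → ℝ) (x : V) : ℝ :=
  (m x)⁻¹ * ∑ᶠ y, w x y * (f y - f x)

/-- The vertex degree `Deg(x) = (1/m(x)) ∑_y w(x,y)`. -/
noncomputable def deg (w : V → V → ℝ) (m : V → ℝ) (x : V) : ℝ :=
  (m x)⁻¹ * ∑ᶠ y, w x y

/-- The set of `d`-lengths of adjacency paths from `x` to `y`. -/
def pathLens (w : V → V → ℝ) (d : V → V → ℝ) (x y : V) : Set ℝ :=
  {L | ∃ (n : ℕ) (p : ℕ → V), p 0 = x ∧ p n = y ∧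
    (∀ i < n, 0 < w (p i) (p (i + 1))) ∧
    L = ∑ i ∈ Finset.range n, d (p i) (p (i + 1))}

/-- `d` is a path metric on the graph with edge weight `w`. -/
def IsPathMetric (w : V → V → ℝ) (d : V → V → ℝ) : Prop :=
  (∀ x, d x x = 0) ∧ (∀ x y, x ≠ y → 0 < d x y) ∧ (∀ x y, d x y = d y x) ∧
  (∀ x y z, d x z ≤ d x y + d y z) ∧
  (∀ x y, d x y = sInf (pathLens w d x y))

/-- All balls are finite. -/
def FiniteBalls (d : V → V → ℝ) : Prop := ∀ (x : V) (R : ℝ), {y | d x y ≤ R}.Finite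

/-- The combinatorial graph distance (as a real number). -/
noncomputable def combDist (w : V → V → ℝ) (x y : V) : ℝ :=
  sInf {L | ∃ (n : ℕ) (p : ℕ → V), p 0 = x ∧ p n = y ∧
    (∀ i < n, 0 < w (p i) (p (i + 1))) ∧ L = (n : ℝ)}

/-- `Lip(1)`: the 1-Lipschitz functions with respect to `d`. -/
def Lip1 (d : V → V → ℝ) (f : V → ℝ) : Prop := ∀ x y, f y - f x ≤ d x y

/-- The Ollivier curvature
`κ(x,y) = (1/d(x,y)) inf{Δf(x) - Δf(y) : f ∈ Lip(1), f(y)-f(x) = d(x,y)}`. -/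
noncomputable def kappa (w : V → V → ℝ) (m : V → ℝ) (d : V → V → ℝ) (x y : V) : ℝ :=
  (d x y)⁻¹ * sInf {c | ∃ f : V → ℝ, Lip1 d f ∧ f y - f x = d x y ∧
    c = lap w m f x - lap w m f y}

/-- `m(A) = ∞`: the total measure of `A` is infinite. -/
def InfVolume (m : V → ℝ) (A : Set V) : Prop :=
  ∀ c : ℝ, ∃ F : Finset V, ↑F ⊆ A ∧ c < ∑ x ∈ F, m x

/-- A salami partition `(X,Y,K)`. -/
def SalamiPartition (w : V → V → ℝ) (m : V → ℝ) (X Y K : Set V) : Prop :=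
  X ∪ Y ∪ K = Set.univ ∧ Disjoint X Y ∧ Disjoint X K ∧ Disjoint Y K ∧
  K.Finite ∧ (∀ x ∈ X, ∀ y ∈ Y, w x y = 0) ∧ InfVolume m X ∧ InfVolume m Y

/-- Reachability inside a subset `A` of the vertex set. -/
def reachIn (w : V → V → ℝ) (A : Set V) : V → V → Prop :=
  Relation.ReflTransGen (fun a b => a ∈ A ∧ b ∈ A ∧ 0 < w a b)

/-- The induced subgraph on `A` is connected. -/
def ConnectedIn (w : V → V → ℝ) (A : Set V) : Prop :=
  ∀ x ∈ A, ∀ y ∈ A, reachIn w A x y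

/-- A connected salami partition: `K` induces a connected subgraph. -/
def ConnectedSalamiPartition (w : V → V → ℝ) (m : V → ℝ) (X Y K : Set V) : Prop :=
  SalamiPartition w m X Y K ∧ ConnectedIn w K

/-- The basic standing assumptions on a weighted graph `G = (V,w,m,d)`:
countable vertex set, symmetric non-negative edge weight vanishing on the diagonal,
positive vertex measure, local finiteness, connectedness,
`d` a path metric with finite balls. -/
def IsGraphBase (w : V → V → ℝ) (m : V → ℝ) (d : V → V → ℝ) : Prop :=
  Countable V ∧ (∀ x y, w x y = w y x) ∧ (∀ x y, 0 ≤ w x y) ∧ (∀ x, w x x = 0) ∧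
  (∀ x, 0 < m x) ∧ LocallyFinite w ∧ GraphConnected w ∧
  IsPathMetric w d ∧ FiniteBalls d

/-- Non-negative Ollivier curvature on all edges. -/
def NonnegCurv (w : V → V → ℝ) (m : V → ℝ) (d : V → V → ℝ) : Prop :=
  ∀ x y, 0 < w x y → 0 ≤ kappa w m d x y

/-- A salami: a connected, locally finite weighted graph with a path metric with
finite balls, non-negative Ollivier curvature, admitting a salami partition. -/
def IsSalami (w : V → V → ℝ) (m : V → ℝ) (d : V → V → ℝ) : Prop :=
  IsGraphBase w m d ∧ NonnegCurv w m d ∧ ∃ X Y K : Set V, SalamiPartition w m X Y K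

/-- `G` has at least `n` ends: there is a finite set `K` such that `V ∖ K` has at
least `n` infinite connected components. -/
def atLeastEnds (w : V → V → ℝ) (n : ℕ) : Prop :=
  ∃ K : Set V, K.Finite ∧ ∃ x : Fin n → V,
    (∀ i, x i ∉ K) ∧ (∀ i, {y | reachIn w Kᶜ (x i) y}.Infinite) ∧
    (∀ i j, i ≠ j → ¬ reachIn w Kᶜ (x i) (x j))

/-- `Lip(1,K)`: functions that are 1-Lipschitz on `K`. -/
def Lip1On (d : V → V → ℝ) (K : Set V) (f : V → ℝ) : Prop :=
  ∀ x ∈ K, ∀ y ∈ K, f y - f x ≤ d x y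

open Classical in
/-- The extremal Lipschitz extension operator `S(P)` of the salami partition
`P = (X,Y,K)`. -/
noncomputable def Sop (d : V → V → ℝ) (X Y K : Set V) (f : V → ℝ) : V → ℝ :=
  fun v =>
    if v ∈ K then f v
    else if v ∈ X then sSup {c | ∃ u ∈ K, c = f u - d v u}
    else sInf {c | ∃ u ∈ K, c = f u + d v u}

/-- `ℱ(P) = S(P)(Lip(1,K))`. -/
def calF (d : V → V → ℝ) (X Y K : Set V) : Set (V → ℝ) :=
  {g | ∃ f : V → ℝ, Lip1On d K f ∧ g = Sop d X Y K f}

/-- `ℋ(P)`: the harmonic functions in `ℱ(P)`. -/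
def calH (w : V → V → ℝ) (m : V → ℝ) (d : V → V → ℝ) (X Y K : Set V) :
    Set (V → ℝ) :=
  {g | g ∈ calF d X Y K ∧ ∀ x, lap w m g x = 0}

/-- `∇₊f(x) = max_{y∼x} (f(y)-f(x))/d(x,y)`. -/
noncomputable def gradPlus (w : V → V → ℝ) (d : V → V → ℝ) (f : V → ℝ) (x : V) : ℝ :=
  sSup {c | ∃ y, 0 < w x y ∧ c = (f y - f x) / d x y}

/-- `∇₋f(x) = max_{y∼x} (f(x)-f(y))/d(x,y)`. -/
noncomputable def gradMinus (w : V → V → ℝ) (d : V → V → ℝ) (f : V → ℝ) (x : V) : ℝ :=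
  sSup {c | ∃ y, 0 < w x y ∧ c = (f x - f y) / d x y}

/-- `|∇f|(x) = max_{y∼x} |f(y)-f(x)|/d(x,y)`. -/
noncomputable def gradAbs (w : V → V → ℝ) (d : V → V → ℝ) (f : V → ℝ) (x : V) : ℝ :=
  sSup {c | ∃ y, 0 < w x y ∧ c = |f y - f x| / d x y}

/-- Recurrence: for every `ε > 0` there is a finitely supported `f` with
`‖f‖∞ = 1` and `-⟨f, Δf⟩ < ε`. -/
def Recurrent (w : V → V → ℝ) (m : V → ℝ) : Prop :=
  ∀ ε : ℝ, 0 < ε → ∃ f : V → ℝ, (Function.support f).Finite ∧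
    (∀ x, |f x| ≤ 1) ∧ (∃ x, |f x| = 1) ∧
    -(∑ᶠ x, f x * lap w m f x * m x) < ε

open Classical in
/-- `∑_{x,y : f(y) < 0 ≤ f(x)} w(x,y)(f(x)-f(y))`. -/
noncomputable def cutSum (w : V → V → ℝ) (f : V → ℝ) : ℝ :=
  ∑ᶠ p : V × V, if f p.2 < 0 ∧ 0 ≤ f p.1 then w p.1 p.2 * (f p.1 - f p.2) else 0

/-- Subexponential growth: `max_{B_r(x)} |u| = e^{o(r)}` as `r → ∞`. -/
def SubexpGrowth (d : V → V → ℝ) (x : V) (u : V → ℝ) : Prop :=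
  Filter.Tendsto
    (fun r : ℕ => Real.log (sSup {c | ∃ y, d x y ≤ (r : ℝ) ∧ c = |u y|}) / (r : ℝ))
    Filter.atTop (nhds 0)


section Graph

variable {w : V → V → ℝ} {m : V → ℝ} {d : V → V → ℝ}

theorem IsPathMetric.nonneg (hd : IsPathMetric w d) (x y : V) : 0 ≤ d x y := by
  rcases eq_or_ne x y with rfl | h
  · exact (hd.1 x).ge
  · exact (hd.2.1 x y h).le

theorem IsPathMetric.le_sum (hd : IsPathMetric w d) (p : ℕ → V) (n : ℕ) :
    d (p 0) (p n) ≤ ∑ i ∈ Finset.range n, d (p i) (p (i + 1)) := by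
  induction n with
  | zero => simp [hd.1]
  | succ n ih =>
    rw [Finset.sum_range_succ]
    linarith [hd.2.2.2.1 (p 0) (p n) (p (n + 1))]

/-- The first vertex of a geodesic from `x` to `y`. -/
theorem exists_adj_dist_add (hb : IsGraphBase w m d) {x y : V} (hxy : x ≠ y) :
    ∃ z, 0 < w x z ∧ d x y = d x z + d z y := by
  obtain ⟨-, -, -, -, -, hloc, -, hd, -⟩ := hb
  by_contra! hcon
  have hlt : ∀ z, 0 < w x z → d x y < d x z + d z y := fun z hz =>
    lt_of_le_of_ne (hd.2.2.2.1 x z y) (hcon z hz)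
  have hstep : ∀ L ∈ pathLens w d x y, ∃ z, 0 < w x z ∧ d x z + d z y ≤ L := by
    rintro L ⟨n, p, h0, hn, hp, rfl⟩
    cases n with
    | zero => exact absurd (h0.symm.trans hn) hxy
    | succ n =>
      refine ⟨p 1, h0 ▸ hp 0 n.succ_pos, ?_⟩
      rw [Finset.sum_range_succ', add_comm, h0]
      have := hd.le_sum (fun i => p (i + 1)) n
      simp only [zero_add, hn] at this ⊢
      linarith
  have hne : (pathLens w d x y).Nonempty := by
    by_contra hemp
    have h1 := hd.2.2.2.2 x y
    rw [Set.not_nonempty_iff_eq_empty.1 hemp, Real.sInf_empty] at h1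
    exact (hd.2.1 x y hxy).ne' h1
  obtain ⟨L₀, hL₀⟩ := hne
  obtain ⟨z₀, hz₀, -⟩ := hstep L₀ hL₀
  obtain ⟨z, hz, hmin⟩ := Set.exists_min_image {z | 0 < w x z} (fun z => d x z + d z y)
    (hloc x) ⟨z₀, hz₀⟩
  have : d x z + d z y ≤ sInf (pathLens w d x y) := by
    refine le_csInf ⟨L₀, hL₀⟩ fun L hL => ?_
    obtain ⟨z', hz', hL'⟩ := hstep L hL
    exact (hmin z' hz').trans hL'
  rw [← hd.2.2.2.2] at this
  exact absurd (hlt z hz) this.not_gt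

/-- Induction along geodesics ending at `y`. -/
theorem geodesic_induction (hb : IsGraphBase w m d) (y : V) (P : V → Prop) (base : P y)
    (step : ∀ x z, 0 < w x z → d x y = d x z + d z y → P z → P x) (x : V) : P x := by
  have hd := hb.2.2.2.2.2.2.2.1
  have hfin := hb.2.2.2.2.2.2.2.2
  by_contra hx
  have hS : {v | d y v ≤ d y x ∧ ¬ P v}.Finite := (hfin y (d y x)).subset fun v hv => hv.1
  obtain ⟨v, ⟨hv, hPv⟩, hmin⟩ := Set.exists_min_image _ (fun v => d y v) hS ⟨x, le_rfl, hx⟩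
  have hvy : v ≠ y := fun h => hPv (h ▸ base)
  obtain ⟨z, hz, hdz⟩ := exists_adj_dist_add hb hvy
  have hvz : v ≠ z := by
    rintro rfl
    exact hz.ne' (hb.2.2.2.1 v)
  have hlt : d y z < d y v := by
    rw [hd.2.2.1 y z, hd.2.2.1 y v]
    linarith [hd.2.1 v z hvz]
  refine hPv (step v z hz hdz ?_)
  by_contra hPz
  exact absurd (hmin z ⟨hlt.le.trans hv, hPz⟩) hlt.not_ge

theorem lap_eq_sum (hb : IsGraphBase w m d) (f : V → ℝ) (x : V) (N : Finset V)
    (hN : ∀ y, 0 < w x y → y ∈ N) :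
    lap w m f x = (m x)⁻¹ * ∑ y ∈ N, w x y * (f y - f x) := by
  rw [lap, finsum_eq_sum_of_support_subset]
  intro y hy
  refine hN y (lt_of_le_of_ne (hb.2.2.1 x y) fun h => hy ?_)
  simp [← h]

theorem deg_eq_sum (hb : IsGraphBase w m d) (x : V) (N : Finset V)
    (hN : ∀ y, 0 < w x y → y ∈ N) :
    deg w m x = (m x)⁻¹ * ∑ y ∈ N, w x y := by
  rw [deg, finsum_eq_sum_of_support_subset]
  intro y hy
  exact hN y (lt_of_le_of_ne (hb.2.2.1 x y) fun h => hy h.symm)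

theorem exists_finset_adj (hb : IsGraphBase w m d) (x : V) :
    ∃ N : Finset V, ∀ y, 0 < w x y ↔ y ∈ N :=
  ⟨(hb.2.2.2.2.2.1 x).toFinset, fun y => by simp⟩

theorem deg_nonneg (hb : IsGraphBase w m d) (x : V) : 0 ≤ deg w m x :=
  mul_nonneg (inv_nonneg.2 (hb.2.2.2.2.1 x).le) (finsum_nonneg fun y => hb.2.2.1 x y)

theorem lap_le_lap_add (hb : IsGraphBase w m d) {f g : V → ℝ} {x : V} {s : ℝ}
    (h : ∀ y, f y - f x ≤ g y - g x + s) : lap w m f x ≤ lap w m g x + deg w m x * s := by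
  obtain ⟨N, hN⟩ := exists_finset_adj hb x
  have hN' : ∀ y, 0 < w x y → y ∈ N := fun y => (hN y).1
  rw [lap_eq_sum hb f x N hN', lap_eq_sum hb g x N hN', deg_eq_sum hb x N hN', mul_assoc,
    ← mul_add, Finset.sum_mul, ← Finset.sum_add_distrib]
  refine mul_le_mul_of_nonneg_left (Finset.sum_le_sum fun y _ => ?_)
    (inv_nonneg.2 (hb.2.2.2.2.1 x).le)
  rw [← mul_add]
  exact mul_le_mul_of_nonneg_left (h y) (hb.2.2.1 x y)

theorem lap_mono (hb : IsGraphBase w m d) {f g : V → ℝ} {x : V}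
    (h : ∀ y, f y - f x ≤ g y - g x) : lap w m f x ≤ lap w m g x := by
  simpa using lap_le_lap_add hb (s := 0) (by simpa using h)

theorem sub_eq_sub_of_lap_eq (hb : IsGraphBase w m d) {f g : V → ℝ} {x : V}
    (h : ∀ y, f y - f x ≤ g y - g x) (heq : lap w m f x = lap w m g x) {y : V}
    (hy : 0 < w x y) : f y - f x = g y - g x := by
  obtain ⟨N, hN⟩ := exists_finset_adj hb x
  have hN' : ∀ y, 0 < w x y → y ∈ N := fun y => (hN y).1
  rw [lap_eq_sum hb f x N hN', lap_eq_sum hb g x N hN'] at heq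
  have heq' := mul_left_cancel₀ (inv_ne_zero (hb.2.2.2.2.1 x).ne') heq
  rw [Finset.sum_eq_sum_iff_of_le
    fun y _ => mul_le_mul_of_nonneg_left (h y) (hb.2.2.1 x y)] at heq'
  exact mul_left_cancel₀ hy.ne' (heq' y (hN' y hy))

theorem lap_neg (f : V → ℝ) (x : V) : lap w m (fun v => -f v) x = -lap w m f x := by
  rw [lap, lap, ← mul_neg, ← finsum_neg_distrib]
  congr 2
  ext y
  ring

theorem Lip1.neg (hb : IsGraphBase w m d) {f : V → ℝ} (hf : Lip1 d f) :
    Lip1 d fun v => -f v := fun x y => by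
  rw [hb.2.2.2.2.2.2.2.1.2.2.1 x y]
  linarith [hf y x]

theorem exists_lap_bound_of_lip1 (hb : IsGraphBase w m d) (x : V) :
    ∃ C, ∀ f, Lip1 d f → lap w m f x ≤ C ∧ -C ≤ lap w m f x := by
  have key : ∃ C, ∀ f, Lip1 d f → lap w m f x ≤ C := by
    refine ⟨lap w m (d x) x, fun f hf => lap_mono hb fun y => ?_⟩
    rw [hb.2.2.2.2.2.2.2.1.1 x, sub_zero]
    exact hf x y
  obtain ⟨C, hC⟩ := key
  refine ⟨C, fun f hf => ⟨hC f hf, ?_⟩⟩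
  have := hC _ (hf.neg hb)
  rw [lap_neg] at this
  linarith

/-- A curvature bound, spelled out for the Laplacians of tight Lipschitz functions. -/
theorem mul_dist_le_lap_sub (hb : IsGraphBase w m d) {a b : V} (hab : 0 < w a b) {k : ℝ}
    (hk : k ≤ kappa w m d a b) {F : V → ℝ} (hF : Lip1 d F) (ht : F b - F a = d a b) :
    k * d a b ≤ lap w m F a - lap w m F b := by
  have hne : a ≠ b := by
    rintro rfl
    exact hab.ne' (hb.2.2.2.1 a)
  have hpos := hb.2.2.2.2.2.2.2.1.2.1 a b hne
  rw [kappa, ← div_eq_inv_mul, le_div_iff₀ hpos] at hk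
  refine hk.trans (csInf_le ?_ ⟨F, hF, ht, rfl⟩)
  obtain ⟨C, hC⟩ := exists_lap_bound_of_lip1 hb a
  obtain ⟨C', hC'⟩ := exists_lap_bound_of_lip1 hb b
  refine ⟨-C - C', ?_⟩
  rintro _ ⟨f, hf, -, rfl⟩
  linarith [(hC f hf).2, (hC' f hf).1]

/-- `Δ + p` is non-increasing along the tight edges of every `1`-Lipschitz function. -/
def TightMono (w : V → V → ℝ) (m : V → ℝ) (d : V → V → ℝ) (p : V → ℝ) : Prop :=
  ∀ a b, 0 < w a b → ∀ F : V → ℝ, Lip1 d F → F b - F a = d a b →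
    lap w m F b + p b ≤ lap w m F a + p a

theorem TightMono.le (hb : IsGraphBase w m d) {p : V → ℝ} (hp : TightMono w m d p)
    {F : V → ℝ} (hF : Lip1 d F) {x y : V} (hxy : F y - F x = d x y) :
    lap w m F y + p y ≤ lap w m F x + p x := by
  revert hxy
  refine geodesic_induction hb y
    (fun x => F y - F x = d x y → lap w m F y + p y ≤ lap w m F x + p x) (fun _ => le_rfl)
    (fun x z hz hd ih hx => ?_) x
  have h1 := hF x z
  have h2 := hF z y
  exact (ih (by linarith)).trans (hp x z hz F hF (by linarith))

/-- A small explicit heat step preserves the Lipschitz bound. -/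
theorem TightMono.heat_step_le (hb : IsGraphBase w m d) {p : V → ℝ} (hp : TightMono w m d p)
    {F : V → ℝ} (hF : Lip1 d F) {e : ℝ} (he : 0 ≤ e) {x y : V}
    (hx : e * deg w m x ≤ 1 / 2) (hy : e * deg w m y ≤ 1 / 2) :
    (F y + e * (lap w m F y + p y)) - (F x + e * (lap w m F x + p x)) ≤ d x y := by
  have hd := hb.2.2.2.2.2.2.2.1
  set s := F x + d x y - F y with hs
  have hs0 : 0 ≤ s := by linarith [hF x y]
  set H : V → ℝ := fun z => max (F z) (F x + d x y - d y z) with hH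
  have hHL : Lip1 d H := fun a b => by
    have h1 : F b ≤ H a + d a b := by
      linarith [hF a b, le_max_left (F a) (F x + d x y - d y a)]
    have h2 : F x + d x y - d y b ≤ H a + d a b := by
      have := hd.2.2.2.1 y b a
      rw [hd.2.2.1 b a] at this
      linarith [le_max_right (F a) (F x + d x y - d y a)]
    linarith [max_le h1 h2]
  have hHx : H x = F x := by
    simp only [hH, hd.2.2.1 y x]
    exact max_eq_left (by linarith)
  have hHy : H y = F x + d x y := by
    simp only [hH, hd.1 y, sub_zero]
    exact max_eq_right (by linarith)
  have hle : ∀ z, F z ≤ H z := fun z => le_max_left _ _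
  have hle' : ∀ z, H z ≤ F z + s := fun z => by
    refine max_le (by linarith) ?_
    have := hF z y
    rw [hd.2.2.1 z y] at this
    linarith
  have htight := hp.le hb hHL (x := x) (y := y) (by linarith)
  have h1 : lap w m F y ≤ lap w m H y + deg w m y * s :=
    lap_le_lap_add hb fun z => by linarith [hle z]
  have h2 : lap w m H x ≤ lap w m F x + deg w m x * s :=
    lap_le_lap_add hb fun z => by linarith [hle' z]
  have h3 := mul_le_mul_of_nonneg_left h1 he
  have h4 := mul_le_mul_of_nonneg_left h2 he
  have h5 := mul_le_mul_of_nonneg_left htight he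
  have h6 := mul_le_mul_of_nonneg_right hx hs0
  have h7 := mul_le_mul_of_nonneg_right hy hs0
  nlinarith

/-- A small explicit heat step preserves upper bounds on the difference of two functions. -/
theorem heat_step_mono (hb : IsGraphBase w m d) {F G : V → ℝ} {c e : ℝ} (he : 0 ≤ e)
    (h : ∀ v, F v ≤ G v + c) {x : V} (hx : e * deg w m x ≤ 1 / 2) :
    F x + e * lap w m F x ≤ G x + e * lap w m G x + c := by
  have h1 : lap w m F x ≤ lap w m G x + deg w m x * (c - (F x - G x)) :=
    lap_le_lap_add hb fun y => by linarith [h y]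
  have h2 := mul_le_mul_of_nonneg_left h1 he
  have h3 : 0 ≤ c - (F x - G x) := by linarith [h x]
  have h4 := mul_le_mul_of_nonneg_right hx h3
  nlinarith

/-- A Lipschitz function that tends to `-∞` on a set of infinite volume with finite boundary
cannot have Laplacian bounded below by a positive constant there. -/
theorem nonpos_of_le_lap (hb : IsGraphBase w m d) {Z : Set V} {K : Finset V}
    (hZ : ∀ x ∈ Z, ∀ y, y ∉ Z → y ∉ K → w x y = 0) (hvol : InfVolume m Z)
    {h : V → ℝ} (hL : Lip1 d h) (hfin : ∀ s, {x | x ∈ Z ∧ s ≤ h x}.Finite)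
    (hZK : ∀ x ∈ Z, x ∉ K) {c : ℝ} (hc : ∀ x ∈ Z, c ≤ lap w m h x) : c ≤ 0 := by
  classical
  by_contra! hpos
  have hd := hb.2.2.2.2.2.2.2.1
  have hsymm := hb.2.1
  have hw := hb.2.2.1
  have hm := hb.2.2.2.2.1
  choose N hN using exists_finset_adj hb
  set C : ℝ := ∑ y ∈ K, ∑ x ∈ N y, w y x * d y x with hC
  obtain ⟨F, hFZ, hF⟩ := hvol (C / c)
  have hFne : F.Nonempty := by
    rw [Finset.nonempty_iff_ne_empty]
    rintro rfl
    rw [Finset.sum_empty] at hF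
    have : 0 ≤ C / c := div_nonneg (Finset.sum_nonneg fun y _ => Finset.sum_nonneg fun x _ =>
      mul_nonneg (hw y x) (hd.nonneg y x)) hpos.le
    linarith
  obtain ⟨x₁, hx₁, hmin⟩ := F.exists_min_image h hFne
  set A := (hfin (h x₁)).toFinset with hA
  have hmem : ∀ x, x ∈ A ↔ x ∈ Z ∧ h x₁ ≤ h x := fun x => by simp [hA]
  have hFA : F ⊆ A := fun x hx => (hmem x).2 ⟨hFZ hx, hmin x hx⟩
  set B := A ∪ K ∪ A.biUnion N with hB
  have hdisj : Disjoint A K := Finset.disjoint_left.2 fun x hx => hZK x ((hmem x).1 hx).1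
  have hlap : ∀ x ∈ A, m x * lap w m h x = ∑ y ∈ B, w x y * (h y - h x) := fun x hx => by
    rw [lap_eq_sum hb h x B fun y hy => Finset.mem_union_right _
      (Finset.mem_biUnion.2 ⟨x, hx, (hN x y).1 hy⟩), mul_inv_cancel_left₀ (hm x).ne']
  have hle : ∀ x ∈ A, ∑ y ∈ B, w x y * (h y - h x) ≤
      ∑ y ∈ A, w x y * (h y - h x) + ∑ y ∈ K, w x y * d x y := fun x hx => by
    rw [← Finset.sum_sdiff (Finset.subset_union_left : A ∪ K ⊆ B), Finset.sum_union hdisj]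
    have h1 : ∑ y ∈ B \ (A ∪ K), w x y * (h y - h x) ≤ 0 := by
      refine Finset.sum_nonpos fun y hy => ?_
      simp only [Finset.mem_sdiff, Finset.mem_union, not_or] at hy
      by_cases hyZ : y ∈ Z
      · have : h y < h x₁ := by
          by_contra! hcon
          exact hy.2.1 ((hmem y).2 ⟨hyZ, hcon⟩)
        exact mul_nonpos_of_nonneg_of_nonpos (hw x y) (by linarith [((hmem x).1 hx).2])
      · simp [hZ x ((hmem x).1 hx).1 y hyZ hy.2.2]
    have h2 : ∑ y ∈ K, w x y * (h y - h x) ≤ ∑ y ∈ K, w x y * d x y :=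
      Finset.sum_le_sum fun y _ => mul_le_mul_of_nonneg_left (hL x y) (hw x y)
    linarith
  have hanti : ∑ x ∈ A, ∑ y ∈ A, w x y * (h y - h x) = 0 := by
    have h1 : ∑ x ∈ A, ∑ y ∈ A, w x y * (h y - h x) =
        -∑ x ∈ A, ∑ y ∈ A, w x y * (h y - h x) := by
      conv_lhs => rw [Finset.sum_comm]
      rw [← Finset.sum_neg_distrib]
      refine Finset.sum_congr rfl fun x _ => ?_
      rw [← Finset.sum_neg_distrib]
      refine Finset.sum_congr rfl fun y _ => ?_
      rw [hsymm y x]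
      ring
    linarith
  have hbd : ∑ x ∈ A, ∑ y ∈ K, w x y * d x y ≤ C := by
    rw [Finset.sum_comm]
    refine Finset.sum_le_sum fun y _ => ?_
    have h1 : ∀ x, w x y * d x y = w y x * d y x := fun x => by rw [hsymm, hd.2.2.1]
    simp only [h1]
    rw [Finset.sum_subset (Finset.subset_union_right : N y ⊆ A ∪ N y) fun x _ hx => ?_]
    · exact Finset.sum_le_sum_of_subset_of_nonneg Finset.subset_union_left
        fun x _ _ => mul_nonneg (hw y x) (hd.nonneg y x)
    · rw [le_antisymm (not_lt.1 fun h0 => hx ((hN y x).1 h0)) (hw y x), zero_mul]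
  have htotal : ∑ x ∈ A, m x * lap w m h x ≤ C := by
    rw [Finset.sum_congr rfl hlap]
    refine (Finset.sum_le_sum hle).trans ?_
    rw [Finset.sum_add_distrib, hanti, zero_add]
    exact hbd
  have hlow : c * ∑ x ∈ F, m x ≤ ∑ x ∈ A, m x * lap w m h x := by
    calc c * ∑ x ∈ F, m x ≤ c * ∑ x ∈ A, m x := mul_le_mul_of_nonneg_left
          (Finset.sum_le_sum_of_subset_of_nonneg hFA fun x _ _ => (hm x).le) hpos.le
      _ = ∑ x ∈ A, m x * c := by rw [mul_comm, Finset.sum_mul]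
      _ ≤ _ := Finset.sum_le_sum fun x hx =>
          mul_le_mul_of_nonneg_left (hc x ((hmem x).1 hx).1) (hm x).le
  rw [div_lt_iff₀ hpos] at hF
  linarith

/-- The separation property of `K` in a partition `(Yᶜ \ K, Y, K)`. -/
def Separates (w : V → V → ℝ) (Y : Set V) (K : Finset V) : Prop :=
  (∀ v ∈ K, v ∉ Y) ∧ ∀ x, x ∉ Y → x ∉ K → ∀ y ∈ Y, w x y = 0

theorem Separates.exists_dist_add (hb : IsGraphBase w m d) {Y : Set V} {K : Finset V}
    (hs : Separates w Y K) {x y : V} (hx : x ∉ Y) (hy : y ∈ Y) :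
    ∃ u ∈ K, d x y = d x u + d u y := by
  have hd := hb.2.2.2.2.2.2.2.1
  revert hx
  refine geodesic_induction hb y (fun x => x ∉ Y → ∃ u ∈ K, d x y = d x u + d u y)
    (fun h => absurd hy h) (fun x z hz hdz ih hx => ?_) x
  by_cases hxK : x ∈ K
  · exact ⟨x, hxK, by rw [hd.1, zero_add]⟩
  · obtain ⟨u, hu, hzu⟩ := ih fun hzY => hz.ne' (hs.2 x hx hxK z hzY)
    exact ⟨u, hu, le_antisymm (hd.2.2.2.1 x u y) (by linarith [hd.2.2.2.1 x z u])⟩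

open Classical in
/-- The extremal extension of a function on `K`: maximal on `Y`, minimal off `Y`. -/
noncomputable def extend (d : V → V → ℝ) (Y : Set V) (K : Finset V) [Nonempty K]
    (f : K → ℝ) : V → ℝ := fun v =>
  if v ∈ Y then Finset.univ.inf' Finset.univ_nonempty fun u : K => f u + d v u
  else Finset.univ.sup' Finset.univ_nonempty fun u : K => f u - d v u

section Extend

variable {Y : Set V} {K : Finset V} [Nonempty K]

theorem extend_le {v : V} (hv : v ∈ Y) (f : K → ℝ) (u : K) :
    extend d Y K f v ≤ f u + d v u := by
  rw [extend, if_pos hv]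
  exact Finset.inf'_le _ (Finset.mem_univ u)

theorem le_extend {v : V} (hv : v ∉ Y) (f : K → ℝ) (u : K) :
    f u - d v u ≤ extend d Y K f v := by
  rw [extend, if_neg hv]
  exact Finset.le_sup' (fun u : K => f u - d v u) (Finset.mem_univ u)

theorem exists_extend_eq_add {v : V} (hv : v ∈ Y) (f : K → ℝ) :
    ∃ u : K, extend d Y K f v = f u + d v u := by
  obtain ⟨u, -, hu⟩ := Finset.exists_mem_eq_inf' Finset.univ_nonempty fun u : K => f u + d v u
  exact ⟨u, by rw [extend, if_pos hv, hu]⟩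

theorem exists_extend_eq_sub {v : V} (hv : v ∉ Y) (f : K → ℝ) :
    ∃ u : K, extend d Y K f v = f u - d v u := by
  obtain ⟨u, -, hu⟩ := Finset.exists_mem_eq_sup' Finset.univ_nonempty fun u : K => f u - d v u
  exact ⟨u, by rw [extend, if_neg hv, hu]⟩

theorem extend_le_extend_add {f g : K → ℝ} {c : ℝ} (h : ∀ u, f u ≤ g u + c) (v : V) :
    extend d Y K f v ≤ extend d Y K g v + c := by
  by_cases hv : v ∈ Y
  · obtain ⟨u, hu⟩ := exists_extend_eq_add (d := d) hv g
    linarith [extend_le (d := d) hv f u, h u]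
  · obtain ⟨u, hu⟩ := exists_extend_eq_sub (d := d) hv f
    linarith [le_extend (d := d) hv g u, h u]

theorem extend_sub_const (f : K → ℝ) (c : ℝ) (v : V) :
    extend d Y K (fun u => f u - c) v = extend d Y K f v - c := by
  have h1 : extend d Y K (fun u => f u - c) v ≤ extend d Y K f v + -c :=
    extend_le_extend_add (fun u => by linarith) v
  have h2 : extend d Y K f v ≤ extend d Y K (fun u => f u - c) v + c :=
    extend_le_extend_add (fun u => by linarith) v
  linarith

theorem continuous_extend (v : V) : Continuous fun f : K → ℝ => extend d Y K f v := by
  refine (LipschitzWith.of_le_add fun f g => ?_).continuous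
  refine extend_le_extend_add (fun u => ?_) v
  have := (le_abs_self _).trans_eq (Real.dist_eq (f u) (g u)).symm
  linarith [dist_le_pi_dist f g u]

theorem extend_coe (hb : IsGraphBase w m d) (hs : Separates w Y K) {f : K → ℝ}
    (hf : ∀ u v : K, f v - f u ≤ d u v) (v : K) : extend d Y K f v = f v := by
  have hd := hb.2.2.2.2.2.2.2.1
  obtain ⟨u, hu⟩ := exists_extend_eq_sub (d := d) (hs.1 v v.2) f
  have h1 := le_extend (d := d) (hs.1 v v.2) f v
  rw [hd.1] at h1
  linarith [hf v u]

theorem lip1_extend (hb : IsGraphBase w m d) (hs : Separates w Y K) {f : K → ℝ}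
    (hf : ∀ u v : K, f v - f u ≤ d u v) : Lip1 d (extend d Y K f) := by
  have hd := hb.2.2.2.2.2.2.2.1
  have hsymm := hd.2.2.1
  have htri := hd.2.2.2.1
  intro x y
  by_cases hx : x ∈ Y <;> by_cases hy : y ∈ Y
  · obtain ⟨u, hu⟩ := exists_extend_eq_add (d := d) hx f
    linarith [extend_le (d := d) hy f u, htri y x u, hsymm x y]
  · obtain ⟨u, hu⟩ := exists_extend_eq_add (d := d) hx f
    obtain ⟨v, hv⟩ := exists_extend_eq_sub (d := d) hy f
    linarith [hf u v, htri u x v, htri x y v, hsymm x u]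
  · obtain ⟨u, hu, hdu⟩ := hs.exists_dist_add hb hx hy
    linarith [extend_le (d := d) hy f ⟨u, hu⟩, le_extend (d := d) hx f ⟨u, hu⟩, hsymm u y]
  · obtain ⟨u, hu⟩ := exists_extend_eq_sub (d := d) hy f
    linarith [le_extend (d := d) hx f u, htri x y u]

theorem continuous_lap_extend (hb : IsGraphBase w m d) (v : V) :
    Continuous fun f : K → ℝ => lap w m (extend d Y K f) v := by
  obtain ⟨N, hN⟩ := exists_finset_adj hb v
  simp only [lap_eq_sum hb _ v N fun y => (hN y).1]
  exact continuous_const.mul (continuous_finsetSum _ fun y _ =>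
    continuous_const.mul ((continuous_extend y).sub (continuous_extend v)))

/-- The discounted equation `ε (Δ + p) f = δ f` is solvable among extremal extensions. -/
theorem exists_discounted (hb : IsGraphBase w m d) (hs : Separates w Y K) {p : V → ℝ}
    (hp : TightMono w m d p) {e : ℝ} (he : 0 ≤ e) (heK : ∀ v ∈ K, e * deg w m v ≤ 1 / 2)
    {r : ℝ} (hr0 : 0 ≤ r) (hr1 : r < 1) :
    ∃ f : K → ℝ, (∀ u v : K, f v - f u ≤ d u v) ∧
      ∀ v : K, r * (f v + e * (lap w m (extend d Y K f) v + p v)) = f v := by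
  have hd := hb.2.2.2.2.2.2.2.1
  set S : Set (K → ℝ) := {f | ∀ u v : K, f v - f u ≤ d u v} with hS
  have hSc : IsClosed S := by
    simp only [hS, Set.ofPred_forall]
    exact isClosed_iInter fun u => isClosed_iInter fun v =>
      isClosed_le ((continuous_apply v).sub (continuous_apply u)) continuous_const
  have hcomp : CompleteSpace S := hSc.isComplete.completeSpace_coe
  have hne : Nonempty S := ⟨⟨0, fun u v => by simpa using hd.nonneg u v⟩⟩
  have hmaps : ∀ f : S, (fun v : K => r * (f.1 v + e * (lap w m (extend d Y K f.1) v + p v)))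
      ∈ S := by
    rintro ⟨f, hf⟩ u v
    have h1 := hp.heat_step_le hb (lip1_extend hb hs hf) he (heK u u.2) (heK v v.2)
    rw [extend_coe hb hs hf, extend_coe hb hs hf] at h1
    have h2 := mul_le_mul_of_nonneg_left h1 hr0
    have h3 := mul_le_mul_of_nonneg_right hr1.le (hd.nonneg u v)
    simp only
    linarith
  lift r to NNReal using hr0 with r hr
  set T : S → S := fun f => ⟨_, hmaps f⟩ with hT
  have hcontr : ContractingWith r T := by
    refine ⟨by exact_mod_cast hr1, LipschitzWith.of_dist_le_mul fun f g => ?_⟩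
    rw [Subtype.dist_eq, Subtype.dist_eq, dist_pi_le_iff (by positivity)]
    intro v
    have key : ∀ f g : S, (T f).1 v - (T g).1 v ≤ r * dist f.1 g.1 := by
      rintro ⟨f, hf⟩ ⟨g, hg⟩
      have h1 := heat_step_mono hb he (fun v => extend_le_extend_add (d := d) (Y := Y)
        (f := f) (g := g) (c := dist f g) (fun u => ?_) v) (heK v v.2)
      · rw [extend_coe hb hs hf, extend_coe hb hs hg] at h1
        have h2 := mul_le_mul_of_nonneg_left h1 r.coe_nonneg
        simp only [hT]
        linarith
      · have := (le_abs_self _).trans_eq (Real.dist_eq (f u) (g u)).symm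
        linarith [dist_le_pi_dist f g u]
    rw [Real.dist_eq, abs_le]
    have h1 := key g f
    rw [dist_comm] at h1
    exact ⟨by linarith, key f g⟩
  obtain ⟨f, hf⟩ : ∃ f, T f = f := ⟨_, hcontr.fixedPoint_isFixedPt⟩
  exact ⟨f.1, f.2, fun v => congrFun (congrArg Subtype.val hf) v⟩

/-- There is an extremal extension on which `Δ + p` is constant along `K`. -/
theorem exists_lap_add_const (hb : IsGraphBase w m d) (hs : Separates w Y K) {p : V → ℝ}
    (hp : TightMono w m d p) :
    ∃ (f : K → ℝ) (c : ℝ), (∀ u v : K, f v - f u ≤ d u v) ∧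
      ∀ v : K, lap w m (extend d Y K f) v + p v = c := by
  have hd := hb.2.2.2.2.2.2.2.1
  obtain ⟨k⟩ := ‹Nonempty K›
  have : Nonempty K := ⟨k⟩
  obtain ⟨e, he, heK⟩ : ∃ e : ℝ, 0 < e ∧ ∀ v ∈ K, e * deg w m v ≤ 1 / 2 := by
    set M := ∑ v ∈ K, deg w m v with hM
    have hM0 : 0 ≤ M := Finset.sum_nonneg fun v _ => deg_nonneg hb v
    refine ⟨1 / (2 * (M + 1)), by positivity, fun v hv => ?_⟩
    have h1 : deg w m v ≤ M := Finset.single_le_sum (fun v _ => deg_nonneg hb v) hv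
    rw [div_mul_eq_mul_div, div_le_div_iff₀ (by positivity) two_pos]
    linarith
  set G : (K → ℝ) → K → ℝ := fun f v => lap w m (extend d Y K f) v + p v with hG
  set S : Set (K → ℝ) := {f | (∀ u v : K, f v - f u ≤ d u v) ∧ f k = 0} with hS
  have hSc : IsCompact S := by
    refine (isCompact_univ_pi fun v : K =>
      (isCompact_Icc : IsCompact (Set.Icc (-d k v) (d k v)))).of_isClosed_subset ?_ ?_
    · simp only [hS, Set.ofPred_and, Set.ofPred_forall]
      exact (isClosed_iInter fun u => isClosed_iInter fun v =>
        isClosed_le ((continuous_apply v).sub (continuous_apply u)) continuous_const).inter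
        (isClosed_eq (continuous_apply k) continuous_const)
    · rintro f ⟨hf, hk⟩ v -
      have h1 := hf k v
      have h2 := hf v k
      rw [hd.2.2.1 v k] at h2
      exact ⟨by linarith, by linarith⟩
  have hSne : S.Nonempty := ⟨0, fun u v => by simpa using hd.nonneg u v, rfl⟩
  set φ : (K → ℝ) → ℝ := fun f => ∑ v, |G f v - G f k| with hφ
  have hGc : ∀ v : K, Continuous fun f => G f v := fun v =>
    (continuous_lap_extend hb v.1).add continuous_const
  have hφc : Continuous φ := continuous_finsetSum _ fun v _ => ((hGc v).sub (hGc k)).abs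
  obtain ⟨f, hfS, hmin⟩ := hSc.exists_isMinOn hSne hφc.continuousOn
  set D : ℝ := ∑ v : K, d k v with hD
  have hD0 : 0 ≤ D := Finset.sum_nonneg fun v _ => hd.nonneg k v
  have hsmall : ∀ t : ℝ, 0 < t → φ f ≤ t * D := by
    intro t ht
    have hden : 0 < 1 + e * t := by positivity
    obtain ⟨g, hg, hgeq⟩ := exists_discounted hb hs hp he.le heK
      (inv_nonneg.2 hden.le) (inv_lt_one_of_one_lt₀ (by linarith [mul_pos he ht]))
    have hGg : ∀ v, G g v = t * g v := fun v => by
      have h1 := hgeq v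
      rw [inv_mul_eq_iff_eq_mul₀ hden.ne'] at h1
      exact mul_left_cancel₀ he.ne' (by simp only [hG]; linarith)
    have hGsub : ∀ v, G (fun u => g u - g k) v = G g v := fun v => by
      simp only [hG, lap, extend_sub_const, sub_sub_sub_cancel_right]
    have hmem : (fun u => g u - g k) ∈ S :=
      ⟨fun u v => by linarith [hg u v], sub_self _⟩
    refine (hmin hmem).trans ?_
    simp only [hφ, hGsub, hGg, hD, Finset.mul_sum]
    refine Finset.sum_le_sum fun v _ => ?_
    rw [← mul_sub, abs_mul, abs_of_pos ht]
    refine mul_le_mul_of_nonneg_left (abs_le.2 ⟨?_, hg k v⟩) ht.le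
    have := hg v k
    rw [hd.2.2.1] at this
    linarith
  have hzero : φ f ≤ 0 := by
    refine le_of_forall_pos_le_add fun t ht => ?_
    have h1 := hsmall (t / (D + 1)) (by positivity)
    have h2 : t / (D + 1) * D ≤ t := by
      rw [div_mul_eq_mul_div, div_le_iff₀ (by positivity)]
      nlinarith
    linarith
  refine ⟨f, G f k, hfS.1, fun v => ?_⟩
  have h1 : |G f v - G f k| ≤ φ f :=
    Finset.single_le_sum (f := fun v => |G f v - G f k|) (fun v _ => abs_nonneg _)
      (Finset.mem_univ v)
  exact sub_eq_zero.1 (abs_nonpos_iff.1 (h1.trans hzero))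

/-- For a partition with both sides of infinite volume, `Δ + p` can be made to vanish on `K`. -/
theorem exists_lap_add_eq_zero (hb : IsGraphBase w m d) (hs : Separates w Y K)
    (hY : InfVolume m Y) (hX : InfVolume m {x | x ∉ Y ∧ x ∉ K}) {p : V → ℝ}
    (hp : TightMono w m d p) (hpK : ∀ v ∉ K, p v = 0) :
    ∃ f : K → ℝ, (∀ u v : K, f v - f u ≤ d u v) ∧
      ∀ v : K, lap w m (extend d Y K f) v + p v = 0 := by
  have hd := hb.2.2.2.2.2.2.2.1
  have hball := hb.2.2.2.2.2.2.2.2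
  obtain ⟨f, c, hf, hc⟩ := exists_lap_add_const hb hs hp
  have hL := lip1_extend hb hs hf
  obtain ⟨M, hM⟩ : ∃ M, ∀ u : K, |f u| ≤ M :=
    ⟨∑ u, |f u|, fun u => Finset.single_le_sum (f := fun u => |f u|)
      (fun u _ => abs_nonneg _) (Finset.mem_univ u)⟩
  have hfinball : ∀ s, {x : V | ∃ u : K, d x u ≤ s}.Finite := fun s => by
    rw [Set.ofPred_exists]
    refine Set.finite_iUnion fun u => (hball u s).subset fun x hx => ?_
    rwa [Set.mem_ofPred_eq, hd.2.2.1]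
  have hle : c ≤ 0 := by
    refine nonpos_of_le_lap hb (K := K) (fun x hx y hy hyK => ?_) hX hL (fun s => ?_)
      (fun x hx => hx.2) (fun x hx => ?_)
    · exact hs.2 x hx.1 hx.2 y (by_contra fun h => hy ⟨h, hyK⟩)
    · refine (hfinball (M - s)).subset fun x hx => ?_
      obtain ⟨u, hu⟩ := exists_extend_eq_sub (d := d) hx.1.1 f
      exact ⟨u, by linarith [hx.2, (abs_le.1 (hM u)).2]⟩
    · obtain ⟨u, hu⟩ := exists_extend_eq_sub (d := d) hx.1 f
      have h1 := hp.le hb hL (x := x) (y := u) (by rw [extend_coe hb hs hf, hu]; ring)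
      rwa [hc, hpK x hx.2, add_zero] at h1
  have hge : -c ≤ 0 := by
    have hYK : ∀ x ∈ Y, x ∉ K := fun x hx hxK => hs.1 x hxK hx
    refine nonpos_of_le_lap hb (K := K) (fun x hx y hy hyK => ?_) hY (hL.neg hb) (fun s => ?_)
      hYK (fun x hx => ?_)
    · rw [hb.2.1]
      exact hs.2 y hy hyK x hx
    · refine (hfinball (M - s)).subset fun x hx => ?_
      obtain ⟨u, hu⟩ := exists_extend_eq_add (d := d) hx.1 f
      exact ⟨u, by linarith [hx.2, (abs_le.1 (hM u)).1]⟩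
    · obtain ⟨u, hu⟩ := exists_extend_eq_add (d := d) hx f
      have h1 := hp.le hb hL (x := u) (y := x)
        (by rw [extend_coe hb hs hf, hu, hd.2.2.1 x u]; ring)
      rw [hc, hpK x (hYK x hx), add_zero] at h1
      rw [lap_neg]
      exact neg_le_neg h1
  exact ⟨f, hf, fun v => (hc v).trans (by linarith)⟩

end Extend

theorem InfVolume.diff_finset {A : Set V} (hA : InfVolume m A) (hm : ∀ x, 0 < m x)
    (K : Finset V) : InfVolume m (A \ K) := by
  classical
  intro c
  obtain ⟨F, hF, hc⟩ := hA (c + ∑ x ∈ K, m x)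
  refine ⟨F \ K, fun x hx => ?_, ?_⟩
  · rw [Finset.mem_coe, Finset.mem_sdiff] at hx
    exact ⟨hF hx.1, hx.2⟩
  · have h1 : ∑ x ∈ F, m x ≤ ∑ x ∈ F \ K, m x + ∑ x ∈ K, m x := by
      rw [← Finset.sum_union Finset.sdiff_disjoint, Finset.sdiff_union_self_eq_union]
      exact Finset.sum_le_sum_of_subset_of_nonneg Finset.subset_union_left
        fun x _ _ => (hm x).le
    linarith

theorem InfVolume.nonempty {A : Set V} (hA : InfVolume m A) : A.Nonempty := by
  obtain ⟨F, hF, hc⟩ := hA 0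
  obtain ⟨x, hx⟩ : F.Nonempty := Finset.nonempty_iff_ne_empty.2 (by rintro rfl; simp at hc)
  exact ⟨x, hF hx⟩

/-- Every salami partition can be enlarged to one whose separating set is a ball at `x`. -/
theorem exists_separating_ball (hb : IsGraphBase w m d) {X Y K : Set V}
    (hP : SalamiPartition w m X Y K) (x : V) :
    ∃ (R : ℝ) (B : Finset V) (Y' : Set V), (∀ v, v ∈ B ↔ d x v ≤ R) ∧ x ∈ B ∧
      Separates w Y' B ∧ InfVolume m Y' ∧ InfVolume m {v | v ∉ Y' ∧ v ∉ B} := by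
  have hd := hb.2.2.2.2.2.2.2.1
  obtain ⟨hun, hXY, hXK, hYK, hK, hw, hX, hY⟩ := hP
  set R := ∑ v ∈ hK.toFinset, d x v with hR
  have hR0 : 0 ≤ R := Finset.sum_nonneg fun v _ => hd.nonneg x v
  set B := (hb.2.2.2.2.2.2.2.2 x R).toFinset with hB
  have hmem : ∀ v, v ∈ B ↔ d x v ≤ R := fun v => by simp [hB]
  have hKB : ∀ v ∈ K, v ∈ B := fun v hv => (hmem v).2 <|
    Finset.single_le_sum (f := fun v => d x v) (fun v _ => hd.nonneg x v)
      (hK.mem_toFinset.2 hv)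
  have hm := hb.2.2.2.2.1
  refine ⟨R, B, Y \ B, hmem, (hmem x).2 (by rwa [hd.1]), ⟨fun v hv h => h.2 hv, ?_⟩,
    hY.diff_finset hm B, ?_⟩
  · intro v hv hvB y hy
    have hvX : v ∈ X := by
      have : v ∈ X ∪ Y ∪ K := hun ▸ Set.mem_univ v
      rcases this with (h | h) | h
      · exact h
      · exact absurd ⟨h, hvB⟩ hv
      · exact absurd (hKB v h) hvB
    exact hw v hvX y hy.1
  · intro c
    obtain ⟨F, hF, hc⟩ := hX.diff_finset hm B c
    exact ⟨F, fun v hv => ⟨fun h => Set.disjoint_left.1 hXY (hF hv).1 h.1, (hF hv).2⟩, hc⟩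

/-- The curvature at a vertex of a salami cannot be bounded below by a positive constant. -/
theorem IsSalami.not_pos_le_kappa (h : IsSalami w m d) (x : V) {k : ℝ} (hk : 0 < k) :
    ¬ ∀ y, 0 < w x y → k ≤ kappa w m d x y := by
  classical
  intro hcurv
  obtain ⟨hb, hnn, X, Y, K, hP⟩ := h
  have hd := hb.2.2.2.2.2.2.2.1
  obtain ⟨R, B, Y', hB, hxB, hs, hY', hX'⟩ := exists_separating_ball hb hP x
  have : Nonempty B := ⟨⟨x, hxB⟩⟩
  obtain ⟨t, ht, htd⟩ : ∃ t, 0 < t ∧ ∀ y, 0 < w x y → t ≤ k * d x y := by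
    rcases Set.eq_empty_or_nonempty {y | 0 < w x y} with hemp | hne
    · exact ⟨1, one_pos, fun y hy => absurd hy (Set.eq_empty_iff_forall_notMem.1 hemp y)⟩
    · obtain ⟨y, hy, hmin⟩ := Set.exists_min_image _ (fun y => k * d x y) (hb.2.2.2.2.2.1 x) hne
      refine ⟨k * d x y, mul_pos hk (hd.2.1 x y ?_), hmin⟩
      rintro rfl
      exact hy.ne' (hb.2.2.2.1 x)
  have hp0 : TightMono w m d 0 := fun a b hab F hF ht => by
    have := mul_dist_le_lap_sub hb hab (hnn a b hab) hF ht
    simp only [Pi.zero_apply]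
    linarith
  have hp1 : TightMono w m d (Pi.single x (-t)) := fun a b hab F hF hFt => by
    have h0 := mul_dist_le_lap_sub hb hab (hnn a b hab) hF hFt
    have hb' : (Pi.single x (-t) : V → ℝ) b ≤ 0 := by
      rw [Pi.single_apply]
      split_ifs <;> linarith
    rcases eq_or_ne a x with rfl | hax
    · have h1 := mul_dist_le_lap_sub hb hab (hcurv b hab) hF hFt
      rw [Pi.single_eq_same]
      linarith [htd b hab]
    · rw [Pi.single_eq_of_ne hax]
      linarith
  obtain ⟨f, hf, hlapf⟩ := exists_lap_add_eq_zero hb hs hY' hX' hp0 fun _ _ => rfl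
  obtain ⟨g, hg, hlapg⟩ := exists_lap_add_eq_zero hb hs hY' hX' hp1 fun v hv =>
    Pi.single_eq_of_ne (ne_of_mem_of_not_mem hxB hv).symm _
  set F := extend d Y' B f with hF
  set G := extend d Y' B g with hG
  obtain ⟨q, hq⟩ := Finite.exists_max fun u : B => g u - f u
  have hmax : ∀ v, G v ≤ F v + (g q - f q) :=
    extend_le_extend_add fun u => by linarith [hq u]
  have hGF : ∀ v : B, lap w m G v = lap w m F v - (Pi.single x (-t) : V → ℝ) v := fun v => by
    have h1 := hlapf v
    have h2 := hlapg v
    simp only [Pi.zero_apply] at h1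
    linarith
  have hnot : ∀ v, v ∈ B → G v - F v = g q - f q → False := by
    refine geodesic_induction hb x _ (fun _ hv => ?_) fun v z hz hvz ih hvB hv => ?_
    · have h1 : lap w m G x ≤ lap w m F x := lap_mono hb fun y => by linarith [hmax y]
      have h2 := hGF ⟨x, hxB⟩
      rw [Pi.single_eq_same] at h2
      linarith
    · have hle : ∀ y, G y - G v ≤ F y - F v := fun y => by linarith [hmax y]
      have h1 : lap w m G v ≤ lap w m F v := lap_mono hb hle
      have h2 := hGF ⟨v, hvB⟩
      have hvx : v ≠ x := by
        rintro rfl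
        rw [Pi.single_eq_same] at h2
        linarith
      rw [Pi.single_eq_of_ne hvx, sub_zero] at h2
      have h3 := sub_eq_sub_of_lap_eq hb hle h2 hz
      refine ih ((hB z).2 ?_) (by linarith)
      have h4 := (hB v).1 hvB
      rw [hd.2.2.1] at h4 ⊢
      linarith [hd.nonneg v z]
  refine hnot q q.2 ?_
  rw [hG, hF, extend_coe hb hs hg, extend_coe hb hs hf]

end Graph

/-- **Corollary (Flatness).** Every salami is flat:
`κ(x) = inf_{y∼x} κ(x,y) = 0` for all `x`. -/
theorem salami_flat {V : Type*} (w : V → V → ℝ) (m : V → ℝ) (d : V → V → ℝ)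
    (h : IsSalami w m d) (x : V) :
    sInf {c | ∃ y, 0 < w x y ∧ c = kappa w m d x y} = 0 := by
  set S := {c | ∃ y, 0 < w x y ∧ c = kappa w m d x y} with hS
  have hnn : ∀ c ∈ S, 0 ≤ c := by
    rintro _ ⟨y, hy, rfl⟩
    exact h.2.1 x y hy
  refine le_antisymm ?_ (Real.sInf_nonneg hnn)
  by_contra! hpos
  exact h.not_pos_le_kappa x hpos fun y hy => csInf_le ⟨0, hnn⟩ ⟨y, hy, rfl⟩

end SalamiPaper
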